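/- arXiv:2011.11457 — 2 statements merged into one kernel-verified Lean document; each statement's English description precedes it below -/
import Mathlib

section
/- Let τ = t + is with t, s orthonormal unit vectors in ℝ^m. For natural numbers k, ℓ with k ≠ ℓ+1, ∫_{S^{m-1}} ⟨ω,τ†⟩^k ⟨ω,τ⟩^ℓ (τ·ω) dS(ω) = 0, and for k = ℓ+1, ∫_{S^{m-1}} ⟨ω,τ†⟩^{ℓ+1} ⟨ω,τ⟩^ℓ (τ·ω) dS(ω) = (-1)^ℓ π^{m/2} (Γ(ℓ+2)/Γ(ℓ+1+m/2)) τ τ†. -/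
open MeasureTheory

/-- The complex Clifford algebra `ℂ_m`: Clifford algebra of `v ↦ -∑ vⱼ²` on `ℂ^m`. -/
noncomputable def Qf (m : ℕ) : QuadraticForm ℂ (Fin m → ℂ) :=
  QuadraticMap.weightedSumSquares ℂ (fun _ : Fin m => (-1 : ℂ))

set_option linter.unusedSectionVars false

lemma gauss_sphere {E : Type*} [NormedAddCommGroup E] [InnerProductSpace ℝ E]
    [FiniteDimensional ℝ E] [MeasurableSpace E] [BorelSpace E] [Nontrivial E]
    (f : E → ℂ) (d : ℕ)
    (hf : ∀ r : ℝ, 0 < r → ∀ x, f (r • x) = (r : ℂ) ^ d * f x) :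
    ∫ x : E, f x * (Real.exp (-‖x‖ ^ 2) : ℂ) =
      (∫ ω : Metric.sphere (0 : E) 1, f ω ∂(volume : Measure E).toSphere) *
        ((Real.Gamma (((Module.finrank ℝ E : ℝ) + d) / 2) / 2 : ℝ) : ℂ) := by
  set N := Module.finrank ℝ E with hN
  have hNpos : 0 < N := Module.finrank_pos
  calc
    _ = ∫ x : ({(0)}ᶜ : Set E), f x.1 * (Real.exp (-‖x.1‖ ^ 2) : ℂ) ∂((volume : Measure E).comap Subtype.val) := by
      rw [integral_subtype_comap (measurableSet_singleton _).compl
        fun x ↦ f x * (Real.exp (-‖x‖ ^ 2) : ℂ), restrict_compl_singleton]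
    _ = ∫ x : Metric.sphere (0 : E) 1 × Set.Ioi (0 : ℝ),
          f x.1 * (((x.2 : ℝ) ^ d * Real.exp (-(x.2 : ℝ) ^ 2) : ℝ) : ℂ)
          ∂(volume : Measure E).toSphere.prod (.volumeIoiPow (N - 1)) := by
      rw [← (volume : Measure E).measurePreserving_homeomorphUnitSphereProd.integral_comp
        (Homeomorph.measurableEmbedding _)]
      congr 1
      ext x
      have hx : 0 < ‖x.1‖ := norm_pos_iff.2 x.2
      simp only [homeomorphUnitSphereProd_apply_fst_coe, homeomorphUnitSphereProd_apply_snd_coe]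
      rw [hf _ (inv_pos.2 hx)]
      push_cast
      have : (‖x.1‖ : ℂ) ≠ 0 := by exact_mod_cast hx.ne'
      field_simp
      rw [mul_assoc, ← mul_pow, one_div_mul_cancel this, one_pow, mul_one]
    _ = (∫ ω : Metric.sphere (0 : E) 1, f ω ∂(volume : Measure E).toSphere) *
         ∫ r : Set.Ioi (0 : ℝ), (((r : ℝ) ^ d * Real.exp (-(r : ℝ) ^ 2) : ℝ) : ℂ)
          ∂(.volumeIoiPow (N - 1)) := 
      integral_prod_mul (fun ω : Metric.sphere (0 : E) 1 => f ω)
        (fun r : Set.Ioi (0 : ℝ) => (((r : ℝ) ^ d * Real.exp (-(r : ℝ) ^ 2) : ℝ) : ℂ))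
    _ = _ := by
      congr 1
      rw [integral_complex_ofReal]
      congr 1
      simp only [Measure.volumeIoiPow, ENNReal.ofReal]
      rw [integral_withDensity_eq_integral_smul,
        integral_subtype_comap measurableSet_Ioi
          fun a : ℝ ↦ Real.toNNReal (a ^ (N - 1)) • (a ^ d * Real.exp (-a ^ 2))]
      · have := integral_rpow_mul_exp_neg_rpow (p := 2) (q := (N + d : ℝ) - 1) (by norm_num)
          (by have : (0:ℝ) < N := by exact_mod_cast hNpos
              have : (0:ℝ) ≤ d := by positivity
              linarith)
        rw [show ((N + d : ℝ) - 1 + 1) = N + d by ring] at this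
        rw [div_eq_inv_mul, ← one_div (2:ℝ), ← this]
        refine setIntegral_congr_fun measurableSet_Ioi fun x hx ↦ ?_
        have hx' : (0:ℝ) < x := hx
        rw [NNReal.smul_def, Real.coe_toNNReal _ (pow_nonneg hx'.le _), smul_eq_mul, ← mul_assoc,
          ← pow_add, ← Real.rpow_natCast]
        congr 2
        · congr 1
          rw [Nat.cast_add, Nat.cast_sub hNpos]; push_cast; ring
        · norm_num
      · exact (measurable_subtype_coe.pow_const _).real_toNNReal

lemma complex_rot (k l : ℕ) (h : k ≠ l) :
    ∫ z : ℂ, (-(starRingEnd ℂ) z) ^ k * z ^ l * (Real.exp (-‖z‖ ^ 2) : ℂ) = 0 := by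
  set F : ℂ → ℂ := fun z => (-(starRingEnd ℂ) z) ^ k * z ^ l * (Real.exp (-‖z‖ ^ 2) : ℂ) with hF
  set θ : ℝ := Real.pi / ((l : ℝ) - k)
  have hlk : (l : ℝ) - k ≠ 0 := sub_ne_zero.2 (by exact_mod_cast h.symm)
  have h1 : ∫ z, F (rotation (Circle.exp θ) z) = ∫ z, F z :=
    (rotation (Circle.exp θ)).measurePreserving.integral_comp
      (rotation (Circle.exp θ)).toHomeomorph.measurableEmbedding F
  have h2 : ∀ z, F (rotation (Circle.exp θ) z) = - F z := by
    intro z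
    have hc : (starRingEnd ℂ (Complex.exp (θ * Complex.I))) ^ k * (Complex.exp (θ * Complex.I)) ^ l
        = -1 := by
      rw [← Complex.exp_conj, ← Complex.exp_nat_mul, ← Complex.exp_nat_mul, ← Complex.exp_add,
        ← Complex.exp_pi_mul_I]
      congr 1
      simp only [map_mul, Complex.conj_ofReal, Complex.conj_I]
      have : (θ : ℂ) * ((l : ℂ) - k) = Real.pi := by
        have : θ * ((l : ℝ) - k) = Real.pi := div_mul_cancel₀ _ hlk
        exact_mod_cast this
      linear_combination Complex.I * this
    simp only [hF, rotation_apply, Circle.coe_exp, map_mul, norm_mul, Complex.norm_exp_ofReal_mul_I, one_mul]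
    rw [← mul_neg, mul_pow, mul_pow]
    linear_combination ((-(starRingEnd ℂ) z) ^ k * z ^ l * (Real.exp (-‖z‖ ^ 2) : ℂ)) * hc
  simp only [h2, integral_neg] at h1
  exact self_eq_neg.1 h1.symm

lemma complex_abs (n : ℕ) :
    ∫ z : ℂ, (-(starRingEnd ℂ) z) ^ n * z ^ n * (Real.exp (-‖z‖ ^ 2) : ℂ)
      = ((-1 : ℂ) ^ n) * ((Real.pi * Real.Gamma (n + 1) : ℝ) : ℂ) := by
  have := Complex.integral_rpow_mul_exp_neg_rpow (p := 2) (q := 2 * n) (by norm_num)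
    (by have : (0:ℝ) ≤ n := by positivity
        linarith)
  rw [show 2 * Real.pi / 2 = Real.pi by ring, show (2 * (n:ℝ) + 2) / 2 = n + 1 by ring] at this
  rw [← this, ← integral_complex_ofReal, ← integral_const_mul]
  congr 1
  ext z
  rw [← mul_pow, neg_mul, mul_comm _ z, Complex.mul_conj', neg_pow, Complex.ofReal_mul, mul_assoc]
  congr 2
  · rw [Real.rpow_mul (norm_nonneg _)]; norm_num
  · norm_num

lemma real_gauss (n : ℕ) :
    ∫ w : Fin n → ℝ, (Real.exp (-∑ i, w i ^ 2) : ℂ) = ((Real.pi ^ ((n : ℝ) / 2) : ℝ) : ℂ) := by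
  rw [integral_complex_ofReal]
  congr 1
  have := integral_fintype_prod_volume_eq_pow (ι := Fin n) (fun x : ℝ => Real.exp (-1 * x ^ 2))
  rw [integral_gaussian] at this
  simp only [← Real.exp_sum, neg_one_mul, Finset.sum_neg_distrib] at this
  rw [this, div_one, Fintype.card_fin, Real.sqrt_eq_rpow, ← Real.rpow_natCast, 
    ← Real.rpow_mul Real.pi_pos.le]
  congr 1; ring

lemma real_odd (n : ℕ) (i : Fin n) :
    ∫ w : Fin n → ℝ, (w i : ℂ) * (Real.exp (-∑ i, w i ^ 2) : ℂ) = 0 := by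
  have := integral_neg_eq_self (fun w : Fin n → ℝ => (w i : ℂ) * (Real.exp (-∑ i, w i ^ 2) : ℂ)) volume
  simp only [Pi.neg_apply, Complex.ofReal_neg, neg_mul, even_two.neg_pow, integral_neg] at this
  exact self_eq_neg.1 this.symm

lemma split_int {E : Type*} [NormedAddCommGroup E] [InnerProductSpace ℝ E]
    [FiniteDimensional ℝ E] [MeasurableSpace E] [BorelSpace E] {n : ℕ}
    (b : OrthonormalBasis (Fin 2 ⊕ Fin n) ℝ E) (F : ℂ → ℂ) (G : (Fin n → ℝ) → ℂ) :
    ∫ x : E, (F (((b.repr x (Sum.inl 0) : ℂ) + (b.repr x (Sum.inl 1) : ℂ) * Complex.I)) * 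
        G (fun i => b.repr x (Sum.inr i))) * (Real.exp (-‖x‖ ^ 2) : ℂ) =
      (∫ z, F z * (Real.exp (-‖z‖ ^ 2) : ℂ)) * 
        ∫ w, G w * (Real.exp (-∑ i, w i ^ 2) : ℂ) := by
  have e1 := b.measurePreserving_repr
  have e2 := PiLp.volume_preserving_ofLp (Fin 2 ⊕ Fin n)
  have e3 := volume_measurePreserving_sumPiEquivProdPi (fun _ : Fin 2 ⊕ Fin n => ℝ)
  have e4 := (Complex.volume_preserving_equiv_pi.symm).prod
    (MeasurePreserving.id (volume : Measure (Fin n → ℝ)))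
  have e := e4.comp (e3.comp (e2.comp e1))
  rw [← integral_prod_mul, ← e.integral_comp]
  · congr 1
    ext x
    have hn : ‖x‖ ^ 2 = ‖((b.repr x (Sum.inl 0) : ℂ) + (b.repr x (Sum.inl 1) : ℂ) * Complex.I)‖ ^ 2 + 
        ∑ i, (b.repr x (Sum.inr i)) ^ 2 := by
      rw [← b.repr.norm_map, EuclideanSpace.norm_sq_eq, ← Complex.normSq_eq_norm_sq,
        Complex.normSq_add_mul_I]
      simp [Fin.sum_univ_two]
    rw [hn, neg_add, Real.exp_add, Complex.ofReal_mul]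
    change _ = F ((b.repr x (Sum.inl 0) : ℂ) + (b.repr x (Sum.inl 1) : ℂ) * Complex.I) * (Real.exp (-‖((b.repr x (Sum.inl 0) : ℂ) + (b.repr x (Sum.inl 1) : ℂ) * Complex.I)‖ ^ 2) : ℂ) * (G (fun i => b.repr x (Sum.inr i)) * (Real.exp (-∑ i, (b.repr x (Sum.inr i)) ^ 2) : ℂ))
    ring
  · refine MeasurableEmbedding.comp ?_ (MeasurableEmbedding.comp ?_ (MeasurableEmbedding.comp ?_ ?_))
    · exact (Complex.measurableEquivPi.symm.prodCongr (MeasurableEquiv.refl _)).measurableEmbedding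
    · exact MeasurableEquiv.measurableEmbedding _
    · exact (MeasurableEquiv.toLp 2 _).symm.measurableEmbedding
    · exact b.repr.toHomeomorph.measurableEmbedding

section main
variable {E : Type*} [NormedAddCommGroup E] [InnerProductSpace ℝ E]
    [FiniteDimensional ℝ E] [MeasurableSpace E] [BorelSpace E] {n : ℕ}

noncomputable def zc (b : OrthonormalBasis (Fin 2 ⊕ Fin n) ℝ E) (x : E) : ℂ :=
  (b.repr x (Sum.inl 0) : ℂ) + (b.repr x (Sum.inl 1) : ℂ) * Complex.I

lemma zc_smul (b : OrthonormalBasis (Fin 2 ⊕ Fin n) ℝ E) (r : ℝ) (x : E) :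
    zc b (r • x) = r * zc b x := by
  simp [zc]; ring

lemma zc_cont (b : OrthonormalBasis (Fin 2 ⊕ Fin n) ℝ E) : Continuous (zc b) := by
  have := b.repr.continuous
  unfold zc
  fun_prop

lemma coord_cont (b : OrthonormalBasis (Fin 2 ⊕ Fin n) ℝ E) (i : Fin 2 ⊕ Fin n) :
    Continuous (fun x => (b.repr x i : ℂ)) := by
  have := b.repr.continuous
  fun_prop

lemma nontriv (b : OrthonormalBasis (Fin 2 ⊕ Fin n) ℝ E) : Nontrivial E :=
  ⟨b (Sum.inl 0), 0, b.orthonormal.ne_zero _⟩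

lemma finr (b : OrthonormalBasis (Fin 2 ⊕ Fin n) ℝ E) : Module.finrank ℝ E = 2 + n := by
  rw [Module.finrank_eq_card_basis b.toBasis]; simp

lemma gam_ne (b : OrthonormalBasis (Fin 2 ⊕ Fin n) ℝ E) (d : ℕ) :
    ((Real.Gamma (((Module.finrank ℝ E : ℝ) + d) / 2) / 2 : ℝ) : ℂ) ≠ 0 := by
  rw [finr b]
  have : 0 < Real.Gamma ((((2 + n : ℕ) : ℝ) + d) / 2) := Real.Gamma_pos_of_pos (by positivity)
  exact_mod_cast (by positivity)

lemma sphere_odd (b : OrthonormalBasis (Fin 2 ⊕ Fin n) ℝ E) (k l : ℕ) (i : Fin n) :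
    ∫ ω : Metric.sphere (0 : E) 1, (-(starRingEnd ℂ) (zc b ω)) ^ k * zc b ω ^ l *
      (b.repr (ω : E) (Sum.inr i) : ℂ) ∂(volume : Measure E).toSphere = 0 := by
  have := nontriv b
  have h := gauss_sphere (fun x => (-(starRingEnd ℂ) (zc b x)) ^ k * zc b x ^ l *
      (b.repr (x : E) (Sum.inr i) : ℂ)) (k + l + 1) (by
        intro r hr x
        simp [zc_smul]
        rw [← mul_neg, mul_pow, mul_pow]; ring)
  have h2 := split_int b (fun z => (-(starRingEnd ℂ) z) ^ k * z ^ l) (fun w => (w i : ℂ))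
  rw [real_odd, mul_zero] at h2
  exact (mul_eq_zero.1 (h.symm.trans h2)).resolve_right (gam_ne b _)

lemma sphere_ne (b : OrthonormalBasis (Fin 2 ⊕ Fin n) ℝ E) (k l : ℕ) (hkl : k ≠ l) :
    ∫ ω : Metric.sphere (0 : E) 1, (-(starRingEnd ℂ) (zc b ω)) ^ k * zc b ω ^ l
       ∂(volume : Measure E).toSphere = 0 := by
  have := nontriv b
  have h := gauss_sphere (fun x => (-(starRingEnd ℂ) (zc b x)) ^ k * zc b x ^ l) (k + l) (by
        intro r hr x
        simp [zc_smul]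
        rw [← mul_neg, mul_pow, mul_pow]; ring)
  have h2 := split_int b (fun z => (-(starRingEnd ℂ) z) ^ k * z ^ l) (fun w => 1)
  rw [complex_rot _ _ hkl, zero_mul] at h2
  simp only [mul_one] at h2
  exact (mul_eq_zero.1 (h.symm.trans h2)).resolve_right (gam_ne b _)

lemma sphere_eq (b : OrthonormalBasis (Fin 2 ⊕ Fin n) ℝ E) (l : ℕ) :
    ∫ ω : Metric.sphere (0 : E) 1, (-(starRingEnd ℂ) (zc b ω)) ^ l * zc b ω ^ l
       ∂(volume : Measure E).toSphere = (-1) ^ l * 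
        ((2 * Real.pi ^ (((2 + n : ℕ) : ℝ) / 2) * 
          (Real.Gamma (l + 1) / Real.Gamma (l + ((2 + n : ℕ) : ℝ) / 2)) : ℝ) : ℂ) := by
  have := nontriv b
  have h := gauss_sphere (fun x => (-(starRingEnd ℂ) (zc b x)) ^ l * zc b x ^ l) (l + l) (by
        intro r hr x
        simp [zc_smul]
        rw [← mul_neg, mul_pow, mul_pow]; ring)
  have h2 := split_int b (fun z => (-(starRingEnd ℂ) z) ^ l * z ^ l) (fun w => 1)
  rw [complex_abs] at h2
  simp only [mul_one, one_mul] at h2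
  rw [real_gauss] at h2
  have h3 := h.symm.trans h2
  refine mul_right_cancel₀ (gam_ne b (l + l)) (h3.trans ?_)
  rw [finr b]
  have hg : 0 < Real.Gamma (l + ((2 + n : ℕ) : ℝ) / 2) := Real.Gamma_pos_of_pos (by positivity)
  rw [show (((2 + n : ℕ) : ℝ) + ((l + l : ℕ) : ℝ)) / 2 = l + ((2 + n : ℕ) : ℝ) / 2 by
    push_cast; ring]
  rw [mul_assoc, mul_assoc, ← Complex.ofReal_mul, ← Complex.ofReal_mul]
  congr 2
  have : Real.pi ^ (((2 + n : ℕ) : ℝ) / 2) = Real.pi * Real.pi ^ ((n : ℝ) / 2) := by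
    rw [show (((2 + n : ℕ) : ℝ) / 2) = 1 + (n : ℝ) / 2 by push_cast; ring,
      Real.rpow_add Real.pi_pos, Real.rpow_one]
  rw [this]
  field_simp

lemma sphere_comb (b : OrthonormalBasis (Fin 2 ⊕ Fin n) ℝ E) (k l : ℕ) (A : ℂ) (c : Fin n → ℂ) :
    ∫ ω : Metric.sphere (0 : E) 1, ((-(starRingEnd ℂ) (zc b ω)) ^ k * zc b ω ^ l) *
      (-(zc b ω / 2) * A + ∑ i, (b.repr (ω : E) (Sum.inr i) : ℂ) * c i)
        ∂(volume : Measure E).toSphere = 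
    (∫ ω : Metric.sphere (0 : E) 1, (-(starRingEnd ℂ) (zc b ω)) ^ k * zc b ω ^ (l + 1)
       ∂(volume : Measure E).toSphere) * (-A / 2) := by
  have hz : Continuous fun ω : Metric.sphere (0 : E) 1 => zc b ω :=
    (zc_cont b).comp continuous_subtype_val
  have hw : ∀ i, Continuous fun ω : Metric.sphere (0 : E) 1 => (b.repr (ω : E) (Sum.inr i) : ℂ) :=
    fun i => (coord_cont b _).comp continuous_subtype_val
  have hint : ∀ f : Metric.sphere (0 : E) 1 → ℂ, Continuous f → 
      Integrable f (volume : Measure E).toSphere := fun f hf =>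
    hf.integrable_of_hasCompactSupport (HasCompactSupport.of_compactSpace f)
  have hconj : Continuous fun ω : Metric.sphere (0 : E) 1 => (starRingEnd ℂ) (zc b ω) :=
    Complex.continuous_conj.comp hz
  calc _ = ∫ ω : Metric.sphere (0 : E) 1, ((-(starRingEnd ℂ) (zc b ω)) ^ k * zc b ω ^ (l + 1)) * 
        (-A / 2) + ∑ i, ((-(starRingEnd ℂ) (zc b ω)) ^ k * zc b ω ^ l * 
          (b.repr (ω : E) (Sum.inr i) : ℂ)) * c i ∂(volume : Measure E).toSphere := by
        congr 1; ext ω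
        rw [mul_add, Finset.mul_sum]
        congr 1
        · ring
        · exact Finset.sum_congr rfl fun i _ => by ring
    _ = _ := by
        rw [integral_add, integral_finsetSum, integral_mul_const]
        · simp only [integral_mul_const, sphere_odd, zero_mul, Finset.sum_const_zero, add_zero]
        · intro i _
          have := hw i
          exact hint _ (by fun_prop)
        · exact hint _ (by fun_prop)
        · exact hint _ (by fun_prop)
end main


/-- Let `τ = t + is` with `t, s` orthonormal unit vectors of `ℝ^m`, `τ† = -t + is`.
For natural numbers `k, ℓ` with `k ≠ ℓ+1`,
`∫_{S^{m-1}} ⟨ω,τ†⟩^k ⟨ω,τ⟩^ℓ (τ·ω) dS(ω) = 0`, and for `k = ℓ+1`,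
`∫_{S^{m-1}} ⟨ω,τ†⟩^{ℓ+1} ⟨ω,τ⟩^ℓ (τ·ω) dS(ω)
  = (-1)^ℓ π^{m/2} (Γ(ℓ+2)/Γ(ℓ+1+m/2)) τ τ†`.
The Clifford-algebra-valued integrals are taken componentwise, i.e. after applying an
arbitrary `ℂ`-linear functional. -/
theorem sphere_integral_tau_omega (m : ℕ) (hm : 2 ≤ m) (t s : Fin m → ℝ)
    (ht : ∑ j, t j ^ 2 = 1) (hs : ∑ j, s j ^ 2 = 1) (hts : ∑ j, t j * s j = 0) :
    let τ : Fin m → ℂ := fun j => (t j : ℂ) + Complex.I * s j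
    let τd : Fin m → ℂ := fun j => -(t j : ℂ) + Complex.I * s j
    let ι := CliffordAlgebra.ι (Qf m)
    let μ := (volume : Measure (EuclideanSpace ℝ (Fin m))).toSphere
    ∀ φ : CliffordAlgebra (Qf m) →ₗ[ℂ] ℂ,
      (∀ k l : ℕ, k ≠ l + 1 →
        (∫ ω : Metric.sphere (0 : EuclideanSpace ℝ (Fin m)) 1,
          φ (((∑ j, ((ω : EuclideanSpace ℝ (Fin m)) j : ℂ) * τd j) ^ k *
              (∑ j, ((ω : EuclideanSpace ℝ (Fin m)) j : ℂ) * τ j) ^ l) •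
            (ι τ * ι (fun j => ((ω : EuclideanSpace ℝ (Fin m)) j : ℂ)))) ∂μ) = 0) ∧
      (∀ l : ℕ,
        (∫ ω : Metric.sphere (0 : EuclideanSpace ℝ (Fin m)) 1,
          φ (((∑ j, ((ω : EuclideanSpace ℝ (Fin m)) j : ℂ) * τd j) ^ (l + 1) *
              (∑ j, ((ω : EuclideanSpace ℝ (Fin m)) j : ℂ) * τ j) ^ l) •
            (ι τ * ι (fun j => ((ω : EuclideanSpace ℝ (Fin m)) j : ℂ)))) ∂μ) =
          φ (((-1 : ℂ) ^ l * ((Real.pi ^ ((m : ℝ) / 2) *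
              (Real.Gamma (l + 2) / Real.Gamma (l + 1 + (m : ℝ) / 2)) : ℝ) : ℂ)) •
            (ι τ * ι τd))) := by
  intro τ τd ι μ φ
  obtain ⟨n, rfl⟩ := Nat.exists_eq_add_of_le hm
  let E := EuclideanSpace ℝ (Fin (2 + n))
  let v : Fin 2 ⊕ Fin n → E := Sum.elim ![WithLp.toLp 2 t, WithLp.toLp 2 s] (fun _ => 0)
  have hv : Orthonormal ℝ ((Set.range (Sum.inl : Fin 2 → Fin 2 ⊕ Fin n)).domRestrict v) := by
    have h0 : Orthonormal ℝ (![WithLp.toLp 2 t, WithLp.toLp 2 s] : Fin 2 → E) := by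
      rw [orthonormal_iff_ite]
      intro i j
      have hin : ∀ u w : Fin (2 + n) → ℝ,
          inner ℝ (WithLp.toLp 2 u : E) (WithLp.toLp 2 w) = ∑ j, u j * w j := by
        intro u w
        simp [E, PiLp.inner_apply, mul_comm]
      have e1 := (hin t t).trans (by simpa [sq] using ht)
      have e2 := (hin s s).trans (by simpa [sq] using hs)
      have e3 := (hin t s).trans hts
      have e4 := (hin s t).trans (by simpa [mul_comm] using hts)
      fin_cases i <;> fin_cases j
      · exact e1
      · exact e3
      · exact e4
      · exact e2
    constructor
    · rintro ⟨_, i, rfl⟩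
      exact h0.1 i
    · rintro ⟨_, i, rfl⟩ ⟨_, j, rfl⟩ hij
      exact h0.2 (fun h => hij (by rw [h]))
  obtain ⟨b, hb⟩ := hv.exists_orthonormalBasis_extension_of_card_eq (by simp [E])
  have hb0 : b (Sum.inl 0) = WithLp.toLp 2 t := hb _ ⟨0, rfl⟩
  have hb1 : b (Sum.inl 1) = WithLp.toLp 2 s := hb _ ⟨1, rfl⟩
  have hr0 : ∀ x : E, b.repr x (Sum.inl 0) = ∑ j, x j * t j := by
    intro x
    rw [b.repr_apply_apply, hb0]
    simp [E, PiLp.inner_apply]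
  have hr1 : ∀ x : E, b.repr x (Sum.inl 1) = ∑ j, x j * s j := by
    intro x
    rw [b.repr_apply_apply, hb1]
    simp [E, PiLp.inner_apply]
  have hz : ∀ x : E, ∑ j, (x j : ℂ) * τ j = zc b x := by
    intro x
    simp only [zc, hr0, hr1, τ, Complex.ofReal_sum, Complex.ofReal_mul, Finset.sum_mul,
      ← Finset.sum_add_distrib]
    exact Finset.sum_congr rfl fun j _ => by ring
  have hzd : ∀ x : E, ∑ j, (x j : ℂ) * τd j = -(starRingEnd ℂ) (zc b x) := by
    intro x
    simp only [zc, hr0, hr1, τd, Complex.ofReal_sum, Complex.ofReal_mul, Finset.sum_mul,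
      ← Finset.sum_add_distrib, map_sum, map_add, map_mul, Complex.conj_ofReal, Complex.conj_I,
      ← Finset.sum_neg_distrib]
    exact Finset.sum_congr rfl fun j _ => by ring
  let L : (Fin (2 + n) → ℂ) →ₗ[ℂ] ℂ := φ ∘ₗ LinearMap.mulLeft ℂ (ι τ) ∘ₗ ι
  have hL : ∀ u, L u = φ (ι τ * ι u) := fun u => rfl
  have hLτ : L τ = 0 := by
    have hsum : ∑ j, τ j * τ j = 0 := by
      have e : ∀ j, τ j * τ j = ((t j ^ 2 : ℝ) : ℂ) - ((s j ^ 2 : ℝ) : ℂ)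
          + 2 * Complex.I * ((t j * s j : ℝ) : ℂ) := by
        intro j
        simp only [τ]
        push_cast
        linear_combination (s j : ℂ) ^ 2 * Complex.I_sq
      simp only [e, Finset.sum_add_distrib, Finset.sum_sub_distrib, ← Finset.mul_sum,
        ← Complex.ofReal_sum, ht, hs, hts]
      simp
    rw [hL, CliffordAlgebra.ι_sq_scalar]
    have : Qf (2 + n) τ = 0 := by
      simp [Qf, QuadraticMap.weightedSumSquares_apply, hsum]
    rw [this]; simp
  let c : Fin n → ℂ := fun i => L (fun j => (b (Sum.inr i) j : ℂ))
  have hω : ∀ x : E, L (fun j => (x j : ℂ)) =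
      -(zc b x / 2) * L τd + ∑ i, (b.repr x (Sum.inr i) : ℂ) * c i := by
    intro x
    have hx : (fun j => (x j : ℂ)) = ((starRingEnd ℂ) (zc b x) / 2) • τ + (-(zc b x / 2)) • τd +
        ∑ i, (b.repr x (Sum.inr i) : ℂ) • (fun j => (b (Sum.inr i) j : ℂ)) := by
      ext j
      have h := congrArg (fun y : E => y j) (b.sum_repr x)
      simp only [Fintype.sum_sum_type, Fin.sum_univ_two, hb0, hb1] at h
      simp only [Pi.add_apply, Finset.sum_apply, Pi.smul_apply, smul_eq_mul]
      conv_lhs => rw [← h]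
      simp [E, zc, τ, τd]
      linear_combination ((b.repr x (Sum.inl 1) : ℂ) * s j) * Complex.I_sq
    rw [hx]
    simp only [map_add, map_sum, map_smul, hLτ, smul_eq_mul, mul_zero, zero_add, c]
  have key : ∀ k l : ℕ, (∫ ω : Metric.sphere (0 : EuclideanSpace ℝ (Fin (2 + n))) 1,
          φ (((∑ j, ((ω : EuclideanSpace ℝ (Fin (2 + n))) j : ℂ) * τd j) ^ k *
              (∑ j, ((ω : EuclideanSpace ℝ (Fin (2 + n))) j : ℂ) * τ j) ^ l) •
            (ι τ * ι (fun j => ((ω : EuclideanSpace ℝ (Fin (2 + n))) j : ℂ)))) ∂μ) =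
      (∫ ω : Metric.sphere (0 : E) 1, (-(starRingEnd ℂ) (zc b ω)) ^ k * zc b ω ^ (l + 1)
       ∂(volume : Measure E).toSphere) * (-L τd / 2) := by
    intro k l
    rw [← sphere_comb b k l (L τd) c]
    congr 1
    ext ω
    rw [map_smul, smul_eq_mul, ← hL, hω, hz, hzd]
  refine ⟨fun k l hkl => ?_, fun l => ?_⟩
  · rw [key, sphere_ne b k (l + 1) hkl, zero_mul]
  · rw [key, sphere_eq b (l + 1), map_smul, ← hL, smul_eq_mul]
    rw [show ((l + 1 : ℕ) : ℝ) + 1 = l + 2 by push_cast; ring, Nat.cast_add l 1, Nat.cast_one]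
    push_cast
    ring
end

section
/- In dimension m = 2, the monogenic projection of ψ_{τ,2s',k} vanishes for s' ≥ 1: with τ = e^{iφ}(e₁ ± i e₂), one has ψ_{τ,2s',k}(z) = (-1)^{s'}(-z²)^{s'} τ e^{iφk}(z₁ ± iz₂)^k, i.e., ψ_{τ,2s',k} is (-z²)^{s'} times a monogenic polynomial of degree k, so its top monogenic component M[ψ_{τ,2s',k}] in the Fischer decomposition is 0 when s' ≥ 1. -/
open scoped TensorProduct

/-- Clifford-algebra-valued polynomials in `m` variables, realized as the tensor product
of the polynomial ring with the Clifford algebra. -/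
abbrev PolyCl (m : ℕ) : Type := MvPolynomial (Fin m) ℂ ⊗[ℂ] CliffordAlgebra (Qf m)

/-- Partial derivative `∂/∂zⱼ` on Clifford-valued polynomials. -/
noncomputable def pd (m : ℕ) (j : Fin m) : PolyCl m →ₗ[ℂ] PolyCl m :=
  LinearMap.rTensor (CliffordAlgebra (Qf m)) (MvPolynomial.pderiv j).toLinearMap

/-- The (complexified) Dirac operator `∂_z = ∑ⱼ eⱼ ∂_{zⱼ}` on Clifford-valued polynomials. -/
noncomputable def dirac (m : ℕ) (F : PolyCl m) : PolyCl m :=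
  ∑ j, ((1 : MvPolynomial (Fin m) ℂ) ⊗ₜ[ℂ] CliffordAlgebra.ι (Qf m) (Pi.single j 1)) *
    pd m j F

/-- The vector variable `z = ∑ⱼ zⱼ eⱼ` as a Clifford-valued polynomial. -/
noncomputable def zvec (m : ℕ) : PolyCl m :=
  ∑ j, (MvPolynomial.X j) ⊗ₜ[ℂ] CliffordAlgebra.ι (Qf m) (Pi.single j 1)

/-- A Clifford-valued polynomial is homogeneous of degree `k` if it is a sum of tensors
`p ⊗ c` with `p` homogeneous of degree `k`. -/
def homog (m : ℕ) (k : ℕ) (F : PolyCl m) : Prop :=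
  F ∈ Submodule.span ℂ
    {x : PolyCl m | ∃ p c, MvPolynomial.IsHomogeneous p k ∧ x = p ⊗ₜ[ℂ] c}

/-- The Laplacian `Δ = -∂_z²` on Clifford-valued polynomials. -/
noncomputable def lapCl (m : ℕ) (F : PolyCl m) : PolyCl m :=
  ∑ j, pd m j (pd m j F)


lemma aux_neg_mul (a b : PolyCl 2) : -a * b = -(a * b) := neg_mul a b

lemma aux_mul_neg (a b : PolyCl 2) : a * -b = -(a * b) := mul_neg a b

lemma aux_neg_one_mul (b : PolyCl 2) : (-1) * b = -b := neg_one_mul b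

lemma aux_mul_neg_one (b : PolyCl 2) : b * (-1) = -b := mul_neg_one b

lemma aux_pd_mul (j : Fin 2) (p : MvPolynomial (Fin 2) ℂ) (c : CliffordAlgebra (Qf 2))
    (F : PolyCl 2) : pd 2 j ((p ⊗ₜ[ℂ] c) * F) =
      (MvPolynomial.pderiv j p ⊗ₜ[ℂ] c) * F + (p ⊗ₜ[ℂ] c) * pd 2 j F := by
  induction F using TensorProduct.induction_on with
  | zero => simp
  | tmul q d =>
    simp only [pd, Algebra.TensorProduct.tmul_mul_tmul, LinearMap.rTensor_tmul,
      Derivation.coeFn_coe, Derivation.leibniz, smul_eq_mul,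
      ← TensorProduct.add_tmul]
    congr 1
    ring
  | add x y hx hy =>
    simp only [mul_add, map_add, hx, hy]
    abel

/-- basis vectors -/
noncomputable def auxE (j : Fin 2) : PolyCl 2 :=
  (1 : MvPolynomial (Fin 2) ℂ) ⊗ₜ[ℂ] CliffordAlgebra.ι (Qf 2) (Pi.single j 1)

/-- scalar variables -/
noncomputable def auxZ (j : Fin 2) : PolyCl 2 :=
  (MvPolynomial.X j : MvPolynomial (Fin 2) ℂ) ⊗ₜ[ℂ] (1 : CliffordAlgebra (Qf 2))

lemma aux_dirac (F : PolyCl 2) :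
    dirac 2 F = auxE 0 * pd 2 0 F + auxE 1 * pd 2 1 F := by
  simp [dirac, auxE, Fin.sum_univ_two]

lemma auxZ_comm (j : Fin 2) (F : PolyCl 2) : auxZ j * F = F * auxZ j := by
  induction F using TensorProduct.induction_on with
  | zero => simp
  | tmul q d => simp [auxZ, mul_comm]
  | add x y hx hy => simp only [mul_add, add_mul, hx, hy]

lemma aux_zvec : zvec 2 = auxZ 0 * auxE 0 + auxZ 1 * auxE 1 := by
  simp [zvec, auxE, auxZ, Fin.sum_univ_two]

lemma aux_ee (j : Fin 2) : auxE j * auxE j = -1 := by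
  have h : CliffordAlgebra.ι (Qf 2) (Pi.single j 1) * CliffordAlgebra.ι (Qf 2) (Pi.single j 1)
      = -1 := by
    rw [CliffordAlgebra.ι_sq_scalar]
    have : Qf 2 (Pi.single j 1) = -1 := by
      fin_cases j <;> simp [Qf, QuadraticMap.weightedSumSquares_apply]
    rw [this]; simp
  simp [auxE, h, TensorProduct.tmul_neg, Algebra.TensorProduct.one_def]

lemma aux_e10 : auxE 1 * auxE 0 = -(auxE 0 * auxE 1) := by
  have h : CliffordAlgebra.ι (Qf 2) (Pi.single 1 1) * CliffordAlgebra.ι (Qf 2) (Pi.single 0 1)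
      = -(CliffordAlgebra.ι (Qf 2) (Pi.single 0 1) *
        CliffordAlgebra.ι (Qf 2) (Pi.single 1 1)) := by
    rw [eq_neg_iff_add_eq_zero, CliffordAlgebra.ι_mul_ι_add_swap]
    have : QuadraticMap.polar (Qf 2) (Pi.single 1 1) (Pi.single 0 1) = 0 := by
      simp [QuadraticMap.polar, Qf, QuadraticMap.weightedSumSquares_apply]
    rw [this]; simp
  simp [auxE, h, TensorProduct.tmul_neg]

lemma aux_zz : zvec 2 * zvec 2 = -(auxZ 0 * auxZ 0 + auxZ 1 * auxZ 1) := by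
  have e : ∀ i j, auxZ i * auxE i * (auxZ j * auxE j) = auxZ i * auxZ j * (auxE i * auxE j) := by
    intro i j
    rw [mul_assoc, ← mul_assoc (auxE i), ← auxZ_comm j (auxE i)]
    simp only [mul_assoc]
  rw [aux_zvec, add_mul, mul_add, mul_add, e, e, e, e, aux_ee, aux_ee, aux_e10,
    auxZ_comm 1 (auxZ 0)]
  simp only [aux_mul_neg, mul_one]
  abel

lemma aux_zz' : zvec 2 * zvec 2 =
    (-(MvPolynomial.X 0 ^ 2 + MvPolynomial.X 1 ^ 2) : MvPolynomial (Fin 2) ℂ) ⊗ₜ[ℂ]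
      (1 : CliffordAlgebra (Qf 2)) := by
  rw [aux_zz]
  simp [auxZ, TensorProduct.add_tmul, TensorProduct.neg_tmul, pow_two]

lemma aux_zz_comm (F : PolyCl 2) : zvec 2 * zvec 2 * F = F * (zvec 2 * zvec 2) := by
  rw [aux_zz]
  simp only [aux_neg_mul, aux_mul_neg, add_mul, mul_add]
  congr 2 <;> rw [mul_assoc, auxZ_comm, auxZ_comm, mul_assoc]

lemma aux_pd_z (j : Fin 2) (F : PolyCl 2) :
    pd 2 j (zvec 2 * F) = auxE j * F + zvec 2 * pd 2 j F := by
  simp only [zvec, Fin.sum_univ_two, add_mul, map_add, aux_pd_mul, MvPolynomial.pderiv_X]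
  fin_cases j <;> simp [auxE] <;> abel

lemma aux_pd_zz (j : Fin 2) (F : PolyCl 2) :
    pd 2 j (zvec 2 * zvec 2 * F) = (-2 : ℂ) • (auxZ j * F) + zvec 2 * zvec 2 * pd 2 j F := by
  rw [aux_zz', aux_pd_mul]
  congr 1
  have : (MvPolynomial.pderiv j) (-(MvPolynomial.X 0 ^ 2 + MvPolynomial.X 1 ^ 2) :
      MvPolynomial (Fin 2) ℂ) = (-2 : ℂ) • MvPolynomial.X j := by
    rw [MvPolynomial.smul_eq_C_mul]
    fin_cases j <;> simp [MvPolynomial.pderiv_X] <;> rfl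
  rw [this, auxZ, ← TensorProduct.smul_tmul', smul_mul_assoc]

lemma aux_dirac_zz (F : PolyCl 2) : dirac 2 (zvec 2 * (zvec 2 * F)) =
    zvec 2 * (zvec 2 * dirac 2 F) + (-2 : ℂ) • (zvec 2 * F) := by
  rw [← mul_assoc, aux_dirac, aux_pd_zz, aux_pd_zz, ← mul_assoc (zvec 2) (zvec 2), aux_dirac F]
  simp only [mul_add, mul_smul_comm]
  rw [← mul_assoc (auxE 0) (zvec 2 * zvec 2), ← mul_assoc (auxE 1) (zvec 2 * zvec 2),
    ← aux_zz_comm, ← aux_zz_comm]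
  have : zvec 2 * F = auxE 0 * (auxZ 0 * F) + auxE 1 * (auxZ 1 * F) := by
    rw [aux_zvec, add_mul, auxZ_comm 0 (auxE 0), auxZ_comm 1 (auxE 1), mul_assoc, mul_assoc]
  rw [this, smul_add]
  simp only [mul_assoc]
  abel

lemma aux_euler (l : ℕ) (F : PolyCl 2) (h : homog 2 l F) :
    auxZ 0 * pd 2 0 F + auxZ 1 * pd 2 1 F = (l : ℂ) • F := by
  unfold homog at h
  induction h using Submodule.span_induction with
  | mem x hx =>
    obtain ⟨p, c, hp, rfl⟩ := hx
    have := hp.sum_X_mul_pderiv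
    rw [Fin.sum_univ_two] at this
    simp only [pd, auxZ, Algebra.TensorProduct.tmul_mul_tmul, LinearMap.rTensor_tmul,
      Derivation.coeFn_coe, one_mul,
      ← TensorProduct.add_tmul, this, TensorProduct.smul_tmul']
    rw [Nat.cast_smul_eq_nsmul]
  | zero => simp
  | add x y _ _ hx hy =>
    rw [smul_add, ← hx, ← hy]
    simp only [map_add, mul_add]; abel
  | smul a x _ hx =>
    rw [smul_comm, ← hx]
    simp only [map_smul, mul_smul_comm, smul_add]

lemma aux_ez (j : Fin 2) : auxE j * zvec 2 = -(zvec 2 * auxE j) + (-2 : ℂ) • auxZ j := by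
  have e : ∀ i, auxE j * (auxZ i * auxE i) = auxZ i * (auxE j * auxE i) := by
    intro i
    rw [← mul_assoc, ← auxZ_comm, mul_assoc]
  have e10 := aux_e10
  rw [aux_zvec, mul_add, e, e, add_mul, mul_assoc, mul_assoc]
  have t : (-2 : ℂ) • auxZ j = -auxZ j - auxZ j := by module
  rw [t]
  fin_cases j <;> simp [aux_ee, e10, aux_neg_mul, aux_mul_neg] <;> abel

lemma aux_dirac_z (l : ℕ) (F : PolyCl 2) (h : homog 2 l F) (hF : dirac 2 F = 0) :
    dirac 2 (zvec 2 * F) = (-(2 + 2 * l) : ℂ) • F := by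
  have hE := aux_euler l F h
  rw [aux_dirac] at hF
  rw [aux_dirac, aux_pd_z, aux_pd_z, mul_add, mul_add, ← mul_assoc, ← mul_assoc, ← mul_assoc,
    ← mul_assoc, aux_ee, aux_ee, aux_ez, aux_ez]
  simp only [add_mul, aux_neg_mul, one_mul, smul_mul_assoc, mul_assoc]
  have h1 : zvec 2 * (auxE 0 * pd 2 0 F) = -(zvec 2 * (auxE 1 * pd 2 1 F)) := by
    rw [eq_neg_iff_add_eq_zero, ← mul_add, hF, mul_zero]
  have h2 : auxZ 0 * pd 2 0 F = (l : ℂ) • F - auxZ 1 * pd 2 1 F := by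
    rw [← hE]; abel
  rw [h1, h2]
  module

lemma aux_dirac_smul (a : ℂ) (F : PolyCl 2) : dirac 2 (a • F) = a • dirac 2 F := by
  simp only [aux_dirac, map_smul, mul_smul_comm, smul_add]

lemma aux_dirac_add (F G : PolyCl 2) : dirac 2 (F + G) = dirac 2 F + dirac 2 G := by
  simp only [aux_dirac, map_add, mul_add]
  abel

lemma aux_dirac_sum (n : ℕ) (f : ℕ → PolyCl 2) :
    dirac 2 (∑ j ∈ Finset.range n, f j) = ∑ j ∈ Finset.range n, dirac 2 (f j) := by
  induction n with
  | zero => simp [aux_dirac]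
  | succ n ih => rw [Finset.sum_range_succ, Finset.sum_range_succ, aux_dirac_add, ih]

lemma aux_pow (l : ℕ) (F : PolyCl 2) (h : homog 2 l F) (hF : dirac 2 F = 0) (s : ℕ) :
    dirac 2 (zvec 2 ^ (2 * s + 1) * F) = (-(2 + 2 * l + 2 * s) : ℂ) • (zvec 2 ^ (2 * s) * F) ∧
    dirac 2 (zvec 2 ^ (2 * s + 2) * F) = (-(2 * s + 2) : ℂ) • (zvec 2 ^ (2 * s + 1) * F) := by
  induction s with
  | zero =>
    constructor
    · simpa using aux_dirac_z l F h hF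
    · have := aux_dirac_zz F
      rw [hF] at this
      simpa [pow_two, mul_assoc] using this
  | succ s ih =>
    have key : ∀ n, zvec 2 ^ (n + 2) * F = zvec 2 * (zvec 2 * (zvec 2 ^ n * F)) := by
      intro n; rw [pow_succ', pow_succ']; simp only [mul_assoc]
    constructor
    · rw [show 2 * (s + 1) + 1 = (2 * s + 1) + 2 by ring, key, aux_dirac_zz, ih.1,
        show 2 * (s + 1) = 2 * s + 2 by ring, key, pow_succ']
      simp only [mul_assoc, mul_smul_comm]
      push_cast
      module
    · rw [show 2 * (s + 1) + 2 = (2 * s + 2) + 2 by ring, key, aux_dirac_zz, ih.2]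
      rw [show 2 * (s + 1) + 1 = (2 * s + 1) + 2 by ring, key (2 * s + 1)]
      have k2 : zvec 2 * (zvec 2 ^ (2 * s + 1) * F) = zvec 2 ^ (2 * s + 2) * F := by
        rw [pow_succ' _ (2 * s + 1), mul_assoc]
      rw [← k2]
      simp only [mul_assoc, mul_smul_comm]
      push_cast
      module

lemma aux_pow' (l : ℕ) (F : PolyCl 2) (h : homog 2 l F) (hF : dirac 2 F = 0) (j : ℕ) :
    ∃ c : ℂ, c ≠ 0 ∧ dirac 2 (zvec 2 ^ (j + 1) * F) = c • (zvec 2 ^ j * F) := by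
  obtain ⟨s, rfl | rfl⟩ := j.even_or_odd'
  · refine ⟨_, ?_, (aux_pow l F h hF s).1⟩
    rw [neg_ne_zero]
    exact_mod_cast (by omega : 2 + 2 * l + 2 * s ≠ 0)
  · refine ⟨_, ?_, (aux_pow l F h hF s).2⟩
    rw [neg_ne_zero]
    exact_mod_cast (by omega : 2 * s + 2 ≠ 0)

lemma aux_unique (n : ℕ) : ∀ M : ℕ → PolyCl 2, (∀ j, dirac 2 (M j) = 0) →
    (∀ j, homog 2 (n - j) (M j)) →
    ∑ j ∈ Finset.range (n + 1), zvec 2 ^ j * M j = 0 → ∀ j ≤ n, M j = 0 := by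
  induction n with
  | zero =>
    intro M _ _ h j hj
    obtain rfl : j = 0 := by omega
    simpa using h
  | succ n ih =>
    intro M hM hh h
    choose c hc hcd using fun j => aux_pow' _ (M (j + 1)) (hh (j + 1)) (hM (j + 1)) j
    have h0 : ∀ j ≤ n, M (j + 1) = 0 := by
      have h' := congrArg (dirac 2) h
      rw [Finset.sum_range_succ', aux_dirac_add, aux_dirac_sum] at h'
      simp only [hcd, pow_zero, one_mul, hM, add_zero] at h'
      have := ih (fun j => c j • M (j + 1)) (fun j => by rw [aux_dirac_smul, hM, smul_zero])
        (fun j => by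
          have := hh (j + 1)
          rw [Nat.add_sub_add_right] at this
          exact Submodule.smul_mem _ _ this)
        (by
          simp only [mul_smul_comm]
          rw [h']
          simp [aux_dirac])
      intro j hj
      exact (smul_eq_zero.mp (this j hj)).resolve_left (hc j)
    intro j hj
    rcases j with _ | j
    · rw [Finset.sum_range_succ', Finset.sum_eq_zero] at h
      · simpa using h
      · intro i hi
        rw [h0 i (by simpa [Nat.lt_succ_iff] using hi), mul_zero]
    · exact h0 j (by omega)

/-- In dimension `m = 2`, with `τ = e^{iφ}(e₁ + ε i e₂)` (`ε = ±1`), the function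
`ψ_{τ,2s',k}(z) = τ⟨z,τ⟩^{s'+k}⟨z,τ†⟩^{s'}` satisfies
`ψ_{τ,2s',k}(z) = z^{2s'} · τ e^{iφk}(z₁ + ε i z₂)^k`, i.e. it is `(-z²)^{s'}` times
(`(-1)^{s'}` times) a monogenic polynomial of degree `k`; consequently, for `s' ≥ 1` the
top (degree `2s'+k`) monogenic component of `ψ_{τ,2s',k}` in its Fischer decomposition
vanishes. -/
theorem psi_dim_two (φ : ℝ) (ε : ℂ) (hε : ε = 1 ∨ ε = -1) (s' k : ℕ) :
    let τ : Fin 2 → ℂ := fun j =>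
      Complex.exp (φ * Complex.I) * (if j = 0 then 1 else ε * Complex.I)
    let τd : Fin 2 → ℂ := fun j =>
      Complex.exp (-φ * Complex.I) * (if j = 0 then -1 else ε * Complex.I)
    let pτ : MvPolynomial (Fin 2) ℂ := ∑ j, MvPolynomial.C (τ j) * MvPolynomial.X j
    let pτd : MvPolynomial (Fin 2) ℂ := ∑ j, MvPolynomial.C (τd j) * MvPolynomial.X j
    let ψ : PolyCl 2 := (pτ ^ (s' + k) * pτd ^ s') ⊗ₜ[ℂ] CliffordAlgebra.ι (Qf 2) τ
    let N : PolyCl 2 :=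
      (MvPolynomial.C (Complex.exp (φ * k * Complex.I)) *
          (MvPolynomial.X 0 + MvPolynomial.C (ε * Complex.I) * MvPolynomial.X 1) ^ k)
        ⊗ₜ[ℂ] CliffordAlgebra.ι (Qf 2) τ
    ψ = zvec 2 ^ (2 * s') * N ∧
    dirac 2 N = 0 ∧
    (1 ≤ s' → ∀ M : ℕ → PolyCl 2,
      (∀ j, dirac 2 (M j) = 0) →
      (∀ j, homog 2 (2 * s' + k - j) (M j)) →
      ψ = ∑ j ∈ Finset.range (2 * s' + k + 1), zvec 2 ^ j * M j →
      M 0 = 0) := by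
  intro τ τd pτ pτd ψ N
  have hε2 : ε * ε = 1 := by rcases hε with rfl | rfl <;> norm_num
  have hII : (ε * Complex.I) * (ε * Complex.I) = -1 := by
    linear_combination Complex.I * Complex.I * hε2 + Complex.I_mul_I
  have hpτ : pτ = MvPolynomial.C (Complex.exp (φ * Complex.I)) *
      (MvPolynomial.X 0 + MvPolynomial.C (ε * Complex.I) * MvPolynomial.X 1) := by
    simp only [pτ, τ, Fin.sum_univ_two]
    simp only [if_true, one_ne_zero, if_false, MvPolynomial.C_mul, MvPolynomial.C_1]
    ring
  have hpp : pτ * pτd = -(MvPolynomial.X 0 ^ 2 + MvPolynomial.X 1 ^ 2) := by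
    have he : (MvPolynomial.C (Complex.exp (φ * Complex.I)) : MvPolynomial (Fin 2) ℂ) *
        MvPolynomial.C (Complex.exp (-φ * Complex.I)) = 1 := by
      rw [← MvPolynomial.C_mul, ← Complex.exp_add]; simp
    have hI : (MvPolynomial.C (ε * Complex.I) : MvPolynomial (Fin 2) ℂ) *
        MvPolynomial.C (ε * Complex.I) = -1 := by
      rw [← MvPolynomial.C_mul, hII]; simp
    have hd : pτd = MvPolynomial.C (Complex.exp (-φ * Complex.I)) *
      (-MvPolynomial.X 0 + MvPolynomial.C (ε * Complex.I) * MvPolynomial.X 1) := by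
      simp only [pτd, τd, Fin.sum_univ_two]
      simp only [if_true, one_ne_zero, if_false, MvPolynomial.C_mul, MvPolynomial.C_1,
        MvPolynomial.C_neg]
      ring
    rw [hpτ, hd]
    generalize (MvPolynomial.C (ε * Complex.I) : MvPolynomial (Fin 2) ℂ) = a at *
    generalize (MvPolynomial.C (Complex.exp (φ * Complex.I)) : MvPolynomial (Fin 2) ℂ) = b at *
    generalize (MvPolynomial.C (Complex.exp (-φ * Complex.I)) : MvPolynomial (Fin 2) ℂ) = c at *
    linear_combination (MvPolynomial.X 0 + a * MvPolynomial.X 1) *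
      (-MvPolynomial.X 0 + a * MvPolynomial.X 1) * he + MvPolynomial.X 1 ^ 2 * hI
  have hψ : ψ = zvec 2 ^ (2 * s') * N := by
    simp only [ψ, N]
    rw [pow_mul, pow_two, aux_zz', Algebra.TensorProduct.tmul_pow, one_pow,
      Algebra.TensorProduct.tmul_mul_tmul, one_mul, ← hpp]
    congr 1
    have : Complex.exp (φ * k * Complex.I) = Complex.exp (φ * Complex.I) ^ k := by
      rw [← Complex.exp_nat_mul]; congr 1; ring
    rw [this, MvPolynomial.C_pow, ← mul_pow, ← hpτ]
    ring
  have hN : dirac 2 N = 0 := by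
    have h0 : pd 2 0 N = (MvPolynomial.C (Complex.exp (φ * k * Complex.I)) * ((k : MvPolynomial (Fin 2) ℂ) *
          (MvPolynomial.X 0 + MvPolynomial.C (ε * Complex.I) * MvPolynomial.X 1) ^ (k - 1)))
        ⊗ₜ[ℂ] CliffordAlgebra.ι (Qf 2) τ := by
      simp [N, pd, MvPolynomial.pderiv_X, Derivation.leibniz_pow]
    have h1 : pd 2 1 N = (ε * Complex.I) • (pd 2 0 N) := by
      rw [h0, TensorProduct.smul_tmul', MvPolynomial.smul_eq_C_mul]
      simp only [N, pd, LinearMap.rTensor_tmul]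
      congr 1
      simp [MvPolynomial.pderiv_X, Derivation.leibniz_pow]
      ring
    have hτ : τ = Complex.exp (φ * Complex.I) •
        (Pi.single 0 1 + (ε * Complex.I) • Pi.single 1 1 : Fin 2 → ℂ) := by
      ext j; fin_cases j <;> simp [τ]
    have hq : CliffordAlgebra.ι (Qf 2) (Pi.single 0 1 + (ε * Complex.I) • Pi.single 1 1) *
        CliffordAlgebra.ι (Qf 2) τ = 0 := by
      rw [hτ, map_smul, mul_smul_comm, CliffordAlgebra.ι_sq_scalar]
      have : Qf 2 (Pi.single 0 1 + (ε * Complex.I) • Pi.single 1 1) = 0 := by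
        simp [Qf, QuadraticMap.weightedSumSquares_apply]
        linear_combination -hII
      rw [this]; simp
    rw [aux_dirac, h1, mul_smul_comm, ← smul_mul_assoc, ← add_mul, h0]
    have : auxE 0 + (ε * Complex.I) • auxE 1 = (1 : MvPolynomial (Fin 2) ℂ) ⊗ₜ[ℂ]
        CliffordAlgebra.ι (Qf 2) (Pi.single 0 1 + (ε * Complex.I) • Pi.single 1 1) := by
      simp only [auxE, map_add, map_smul, TensorProduct.tmul_add, TensorProduct.tmul_smul]
    rw [this, Algebra.TensorProduct.tmul_mul_tmul, hq, TensorProduct.tmul_zero]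
  refine ⟨hψ, hN, ?_⟩
  intro hs M hM hh hsum
  have hNh : homog 2 k N := by
    refine Submodule.subset_span ⟨_, _, ?_, rfl⟩
    have h1 : MvPolynomial.IsHomogeneous (MvPolynomial.X 0 +
        MvPolynomial.C (ε * Complex.I) * MvPolynomial.X 1 : MvPolynomial (Fin 2) ℂ) 1 :=
      (MvPolynomial.isHomogeneous_X _ _).add (MvPolynomial.isHomogeneous_C_mul_X _ _)
    have h2 := (MvPolynomial.isHomogeneous_C (Fin 2)
      (Complex.exp (φ * k * Complex.I))).mul (h1.pow k)
    simpa using h2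
  have := aux_unique (2 * s' + k) (fun j => M j + (-1 : ℂ) • (if j = 2 * s' then N else 0))
    (fun j => by
      rw [aux_dirac_add, aux_dirac_smul, hM]
      split_ifs
      · simp [hN]
      · simp [aux_dirac])
    (fun j => by
      refine Submodule.add_mem _ (hh j) (Submodule.smul_mem _ _ ?_)
      split_ifs with h
      · subst h
        rw [Nat.add_sub_cancel_left]
        exact hNh
      · exact Submodule.zero_mem _)
    (by
      simp only [mul_add, Finset.sum_add_distrib, ← hsum, mul_smul_comm, mul_ite, mul_zero,
        smul_ite, smul_zero]
      rw [Finset.sum_ite_eq', if_pos (by simp), hψ]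
      module)
    0 (by omega)
  have hs0 : ¬ (0 = 2 * s') := by omega
  simpa [hs0] using this
end
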